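/- arXiv:2602.13354 — 2 statements merged into one kernel-verified Lean document; each statement's English description precedes it below -/
import Mathlib

section
/- Let G be a finite group, H and K subgroups of G, α an irreducible character of H, and β an irreducible character of K. If the restrictions α_{H∩K} and β_{H∩K} have a common irreducible constituent (equivalently, [α_{H∩K}, β_{H∩K}] ≠ 0), then there exists an irreducible character ω of G such that [ω_H, α] ≠ 0 and [ω_K, β] ≠ 0. -/
open scoped BigOperators Classical

noncomputable section

/-- Inner product of class functions on a finite group. -/
def charInner (G : Type*) [Group G] [Fintype G] (f g : G → ℂ) : ℂ :=
  (Fintype.card G : ℂ)⁻¹ * ∑ x : G, f x * (starRingEnd ℂ) (g x)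

/-- `χ` is the character of some finite-dimensional complex representation. -/
def IsChar (G : Type*) [Group G] (χ : G → ℂ) : Prop :=
  ∃ (n : ℕ) (ρ : Representation ℂ G (Fin n → ℂ)),
    ∀ g : G, χ g = LinearMap.trace ℂ (Fin n → ℂ) (ρ g)

/-- Irreducible character: a character of norm one. -/
def IsIrrChar (G : Type*) [Group G] [Fintype G] (χ : G → ℂ) : Prop :=
  IsChar G χ ∧ charInner G χ χ = 1

/-- Restriction of a character of `H` to a smaller subgroup `K ≤ H`. -/
def resChar {G : Type*} [Group G] {K H : Subgroup G} (h : K ≤ H) (φ : H → ℂ) :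
    K → ℂ := fun k => φ (Subgroup.inclusion h k)

/-- Induced class function from a subgroup `H` up to `G`. -/
def inducedChar {G : Type*} [Group G] [Fintype G] (H : Subgroup G) (α : H → ℂ) :
    G → ℂ := fun g =>
  (Fintype.card H : ℂ)⁻¹ *
    ∑ x : G, if h : x * g * x⁻¹ ∈ H then α ⟨x * g * x⁻¹, h⟩ else 0

/-- Induced class function from a subgroup `A` up to a larger subgroup `B`. -/
def inducedCharSub {G : Type*} [Group G] [Fintype G] {A B : Subgroup G}
    (_ : A ≤ B) (η : A → ℂ) : B → ℂ := fun b =>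
  (Fintype.card A : ℂ)⁻¹ *
    ∑ x : B, if h : (x : G) * (b : G) * (x : G)⁻¹ ∈ A then η ⟨_, h⟩ else 0

open Matrix ComplexOrder in
theorem Representation.character_inv_eq_conj {G V : Type*} [Group G] [Finite G] [AddCommGroup V]
    [Module ℂ V] [FiniteDimensional ℂ V] (ρ : Representation ℂ G V) (g : G) :
    ρ.character g⁻¹ = starRingEnd ℂ (ρ.character g) := by
  classical
  have := Fintype.ofFinite G
  let b := Module.finBasis ℂ V
  let M : G → Matrix _ _ ℂ := fun x => LinearMap.toMatrix b b (ρ x)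
  have hM : ∀ x y, M (x * y) = M x * M y := fun x y => by
    simp only [M, map_mul, LinearMap.toMatrix_mul]
  have hM1 : M 1 = 1 := by simp [M, Module.End.one_eq_id]
  have htr : ∀ x, ρ.character x = (M x).trace := fun x =>
    LinearMap.trace_eq_matrix_trace ℂ b (ρ x)
  let P := ∑ x, (M x)ᴴ * M x
  have hP : P.PosDef := by
    have : P = (M 1)ᴴ * M 1 + ∑ x ∈ Finset.univ.erase 1, (M x)ᴴ * M x :=
      (Finset.add_sum_erase _ _ (Finset.mem_univ 1)).symm
    rw [this, hM1]
    refine PosDef.add_posSemidef (by simpa using PosDef.one) ?_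
    exact posSemidef_sum _ fun x _ => posSemidef_conjTranspose_mul_self _
  have hinv : (M g)ᴴ * P * M g = P := by
    simp only [P, Finset.mul_sum, Finset.sum_mul]
    refine Fintype.sum_equiv (Equiv.mulRight g) _ _ fun x => ?_
    simp [hM, Matrix.mul_assoc]
  have hu : IsUnit P.det := (Matrix.isUnit_iff_isUnit_det _).1 hP.isUnit
  have hg : M g * M g⁻¹ = 1 := by rw [← hM, mul_inv_cancel, hM1]
  have key : (M g)ᴴ * P = P * M g⁻¹ := by
    calc (M g)ᴴ * P = (M g)ᴴ * P * (M g * M g⁻¹) := by rw [hg, Matrix.mul_one]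
      _ = P * M g⁻¹ := by rw [← Matrix.mul_assoc, hinv]
  rw [htr, htr, starRingEnd_apply, ← trace_conjTranspose]
  calc (M g⁻¹).trace = (P⁻¹ * (P * M g⁻¹)).trace := by
        rw [← Matrix.mul_assoc, nonsing_inv_mul _ hu, Matrix.one_mul]
    _ = (M g)ᴴ.trace := by
        rw [← key, trace_mul_comm, Matrix.mul_assoc, mul_nonsing_inv _ hu, Matrix.mul_one]

theorem IsChar.apply_inv {G : Type*} [Group G] [Finite G] {χ : G → ℂ} (hχ : IsChar G χ) (g : G) :
    χ g⁻¹ = starRingEnd ℂ (χ g) := by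
  obtain ⟨n, ρ, hρ⟩ := hχ
  rw [hρ, hρ]
  exact ρ.character_inv_eq_conj g

theorem Representation.isChar_character {G V : Type*} [Group G] [AddCommGroup V]
    [Module ℂ V] [FiniteDimensional ℂ V] (ρ : Representation ℂ G V) : IsChar G ρ.character := by
  let e := (Module.finBasis ℂ V).equivFun
  refine ⟨_, e.conjAlgEquiv ℂ |>.toAlgHom.toMonoidHom.comp ρ, fun g => ?_⟩
  exact (LinearMap.trace_conj' (ρ g) e).symm

theorem Representation.isIrrChar_character {G V : Type*} [Group G] [Fintype G] [AddCommGroup V]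
    [Module ℂ V] [FiniteDimensional ℂ V] (ρ : Representation ℂ G V) [ρ.IsIrreducible] :
    IsIrrChar G ρ.character := by
  refine ⟨ρ.isChar_character, ?_⟩
  have : Invertible (Nat.card G : ℂ) := invertibleOfNonzero (NeZero.ne _)
  have h := ρ.card_inv_mul_sum_char_mul_char_eq_finrank ρ
  simpa [charInner, ρ.character_inv_eq_conj] using h

/-- The convolution square of an irreducible character is a nonzero multiple of it. -/
theorem IsIrrChar.exists_convolution_eq {G : Type*} [Group G] [Fintype G] {α : G → ℂ}
    (hα : IsIrrChar G α) :
    ∃ c : ℂ, c ≠ 0 ∧ ∀ x, ∑ h, α h⁻¹ * α (x * h) = c * α x := by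
  have hinv := hα.1.apply_inv
  obtain ⟨⟨n, σ, hσ⟩, hn⟩ := hα
  have : Invertible (Nat.card G : ℂ) := invertibleOfNonzero (NeZero.ne _)
  have hα : α = σ.character := funext hσ
  have hrank : Module.finrank ℂ (σ.IntertwiningMap σ) = 1 := by
    have h := σ.card_inv_mul_sum_char_mul_char_eq_finrank σ
    rw [← hα] at h
    simp only [hinv, Nat.card_eq_fintype_card] at h
    rw [charInner] at hn
    rw [hn] at h
    exact_mod_cast h.symm
  let S : Module.End ℂ (Fin n → ℂ) := ∑ h, α h⁻¹ • σ h
  have hcomm : ∀ g, S ∘ₗ σ g = σ g ∘ₗ S := fun g => by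
    change S * σ g = σ g * S
    simp only [S, Finset.sum_mul, Finset.mul_sum, smul_mul_assoc, mul_smul_comm, ← map_mul]
    refine Fintype.sum_equiv (MulAut.conj g⁻¹).toEquiv _ _ fun h => ?_
    have : α (g⁻¹ * h * g)⁻¹ = α h⁻¹ := by
      have := σ.char_conj h⁻¹ g⁻¹
      rw [hα, ← this]; congr 1; group
    simp only [MulEquiv.toEquiv_eq_coe, EquivLike.coe_coe, MulAut.conj_apply, inv_inv, this]
    congr 2
    group
  have hne : (Representation.IntertwiningMap.id σ) ≠ 0 := by
    intro h0
    have hz : ∀ f : σ.IntertwiningMap σ, f = 0 := fun f => by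
      refine DFunLike.ext _ _ fun v => ?_
      have := congrArg (fun f' : σ.IntertwiningMap σ => f (f' v)) h0
      simpa using this
    have := subsingleton_of_forall_eq _ hz
    simp [Module.finrank_zero_of_subsingleton] at hrank
  obtain ⟨c, hc⟩ := (finrank_eq_one_iff_of_nonzero' _ hne).1 hrank ⟨S, hcomm⟩
  have hS : S = c • 1 := by
    refine LinearMap.ext fun v => ?_
    exact (congrArg (fun f : σ.IntertwiningMap σ => f v) hc).symm
  have hconv : ∀ x, ∑ h, α h⁻¹ * α (x * h) = c * α x := fun x => by
    have := congrArg (fun T => LinearMap.trace ℂ _ (σ x * T)) hS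
    simpa [S, Finset.mul_sum, ← map_mul, ← hσ] using this
  refine ⟨c, ?_, hconv⟩
  rintro rfl
  have h1 := hconv 1
  simp only [hinv, one_mul, zero_mul] at h1
  simp [charInner, mul_comm (α _), h1] at hn

theorem IsIrrChar.sum_smul_eq_zero {G V : Type*} [Group G] [Fintype G] [AddCommGroup V]
    [Module ℂ V] [FiniteDimensional ℂ V] {α : G → ℂ} (hα : IsIrrChar G α)
    (ρ : Representation ℂ G V) (h : charInner G ρ.character α = 0) :
    ∑ g, α g⁻¹ • ρ g = 0 := by
  obtain ⟨c, hc, hconv⟩ := hα.exists_convolution_eq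
  set T := ∑ g, α g⁻¹ • ρ g with hT
  have hsq : T * T = c • T := by
    calc T * T = ∑ g, ∑ x, (α g⁻¹ * α (x⁻¹ * g)) • ρ x := by
          rw [hT, Finset.sum_mul]
          refine Finset.sum_congr rfl fun g _ => ?_
          rw [Finset.mul_sum]
          refine Fintype.sum_equiv (Equiv.mulLeft g) _ _ fun y => ?_
          simp [smul_smul, mul_comm]
      _ = c • T := by
          rw [Finset.sum_comm]
          simp only [← Finset.sum_smul, hconv, hT, Finset.smul_sum, smul_smul]
  have hid : IsIdempotentElem (c⁻¹ • T) := by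
    rw [IsIdempotentElem, smul_mul_smul_comm, hsq, smul_smul, mul_assoc, inv_mul_cancel₀ hc,
      mul_one]
  have htr : LinearMap.trace ℂ V T = 0 := by
    have : ∑ g, ρ.character g * starRingEnd ℂ (α g) = 0 := by
      simpa [charInner] using h
    rw [hT, map_sum, ← this]
    refine Finset.sum_congr rfl fun g _ => ?_
    rw [map_smul, smul_eq_mul, mul_comm, hα.1.apply_inv, Representation.character]
  have := LinearMap.IsIdempotentElem.eq_zero_of_trace_eq_zero hid (by rw [map_smul, htr, smul_zero])
  exact (smul_eq_zero.1 this).resolve_left (inv_ne_zero hc)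

theorem Representation.asAlgebraHom_ofModule'_apply {k G N : Type*} [CommSemiring k] [Monoid G]
    [AddCommMonoid N] [Module k N] [Module (MonoidAlgebra k G) N]
    [IsScalarTower k (MonoidAlgebra k G) N] (r : MonoidAlgebra k G) (x : N) :
    (Representation.ofModule' (k := k) (G := G) N).asAlgebraHom r x = r • x := by
  simp [Representation.asAlgebraHom, Representation.ofModule']

theorem Representation.isIrreducible_ofModule' {k G N : Type*} [Field k] [Monoid G]
    [AddCommGroup N] [Module k N] [Module (MonoidAlgebra k G) N]
    [IsScalarTower k (MonoidAlgebra k G) N] [IsSimpleModule (MonoidAlgebra k G) N] :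
    (Representation.ofModule' (k := k) (G := G) N).IsIrreducible := by
  rw [Representation.irreducible_iff_isSimpleModule_asModule]
  let ρ := Representation.ofModule' (k := k) (G := G) N
  let e : ρ.asModule ≃ₗ[MonoidAlgebra k G] N :=
    { ρ.asModuleEquiv with
      map_smul' := fun r x => (ρ.asModuleEquiv_map_smul r x).trans
        (Representation.asAlgebraHom_ofModule'_apply r _) }
  exact IsSimpleModule.congr e

/-- A nonzero element of the group algebra of a finite group acts nontrivially on some simple
submodule of the group algebra. -/
theorem MonoidAlgebra.exists_isSimpleModule_smul_ne_zero {k G : Type*} [Field k] [Group G]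
    [Finite G] [NeZero (Nat.card G : k)] {a : MonoidAlgebra k G} (ha : a ≠ 0) :
    ∃ N : Submodule (MonoidAlgebra k G) (MonoidAlgebra k G),
      IsSimpleModule (MonoidAlgebra k G) N ∧ ∃ x : N, a • x ≠ 0 := by
  by_contra! hcon
  have hall : ∀ x ∈ (⊤ : Submodule (MonoidAlgebra k G) (MonoidAlgebra k G)), a * x = 0 := by
    rw [← IsSemisimpleModule.sSup_simples_eq_top, sSup_eq_iSup']
    intro x hx
    induction hx using Submodule.iSup_induction' with
    | mem N x hx => exact congrArg Subtype.val (hcon N.1 N.2 ⟨x, hx⟩)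
    | zero => exact mul_zero a
    | add x y _ _ hx hy => rw [mul_add, hx, hy, add_zero]
  exact ha (by simpa using hall 1 trivial)

/-- if the restrictions of `α ∈ Irr(H)` and `β ∈ Irr(K)` to `H ∩ K`
have a common irreducible constituent, i.e. `[α_{H∩K}, β_{H∩K}] ≠ 0`, then some
`ω ∈ Irr(G)` lies over both `α` and `β`. -/
theorem exists_irr_over_of_inner_ne_zero {G : Type*} [Group G] [Fintype G]
    (H K : Subgroup G) (α : H → ℂ) (β : K → ℂ)
    (hα : IsIrrChar H α) (hβ : IsIrrChar K β)
    (h : charInner ↥(H ⊓ K) (resChar inf_le_left α) (resChar inf_le_right β) ≠ 0) :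
    ∃ ω : G → ℂ, IsIrrChar G ω ∧
      charInner H (fun x => ω (x : G)) α ≠ 0 ∧
      charInner K (fun x => ω (x : G)) β ≠ 0 := by
  let a : MonoidAlgebra ℂ G := ∑ x : H, MonoidAlgebra.single (x : G) (α x⁻¹)
  let b : MonoidAlgebra ℂ G := ∑ x : K, MonoidAlgebra.single (x : G) (β x⁻¹)
  have hab : a * b ≠ 0 := by
    intro h0
    have h1 : ∑ x : H, ∑ y : K, (if (x : G) * y = 1 then α x⁻¹ * β y⁻¹ else 0) = 0 := by
      have := congrArg (fun f => f.coeff 1) h0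
      simpa [a, b, Finset.sum_mul_sum, MonoidAlgebra.single_mul_single, Finsupp.single_apply,
        ← ite_and] using this
    apply h
    rw [charInner]
    refine mul_eq_zero_of_right _ (Eq.trans ?_ h1)
    rw [← Fintype.sum_prod_type']
    let e : ↥(H ⊓ K) → H × K := fun z => (⟨z, z.2.1⟩⁻¹, ⟨z, z.2.2⟩)
    refine Fintype.sum_of_injective e ?_ _ _ ?_ ?_
    · intro z w hzw
      exact Subtype.ext (congrArg (fun p => (p.2 : G)) hzw)
    · rintro ⟨x, y⟩ hxy
      refine if_neg fun h1 => hxy ?_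
      have hx : (x : G) = (y : G)⁻¹ := eq_inv_of_mul_eq_one_left h1
      have hy : (y : G) ∈ H := by rw [← inv_mem_iff, ← hx]; exact x.2
      exact ⟨⟨y, hy, y.2⟩, Prod.ext (Subtype.ext hx.symm) rfl⟩
    · intro z
      simp [e, resChar, hβ.1.apply_inv, Subgroup.inclusion]
  obtain ⟨N, hN, x, hx⟩ := MonoidAlgebra.exists_isSimpleModule_smul_ne_zero hab
  have : FiniteDimensional ℂ N :=
    FiniteDimensional.finiteDimensional_submodule (N.restrictScalars ℂ)
  let ρ := Representation.ofModule' (k := ℂ) (G := G) N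
  have : ρ.IsIrreducible := Representation.isIrreducible_ofModule'
  have hne : ρ.asAlgebraHom (a * b) ≠ 0 := fun h0 => hx <| by
    rw [← Representation.asAlgebraHom_ofModule'_apply (k := ℂ), h0, LinearMap.zero_apply]
  rw [map_mul] at hne
  refine ⟨ρ.character, ρ.isIrrChar_character, fun h0 => left_ne_zero_of_mul hne ?_,
    fun h0 => right_ne_zero_of_mul hne ?_⟩
  · simpa [a] using hα.sum_smul_eq_zero (ρ.comp H.subtype) h0
  · simpa [b] using hβ.sum_smul_eq_zero (ρ.comp K.subtype) h0
end
end

section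
/- Let p be a prime, e ≥ 0, G a finite p-group with p^{e+1} dividing |G|, and let I be the intersection of all subgroups of G of order p^{e+1}. Then |I ∩ Z(G)| ≤ |π_0(Γ_{p,e}(G))|, i.e., the number of connected components of Γ_{p,e}(G) is at least the order of I ∩ Z(G). -/
open scoped BigOperators Classical

noncomputable section

/-- Elements of the poset `Γ_{p,e}(G)`: pairs `(H, φ)` with `|H| ≥ p^(e+1)` and
`φ ∈ Irr(H)`. -/
structure GammaPair (p e : ℕ) (G : Type*) [Group G] [Fintype G] where
  H : Subgroup G
  hH : p ^ (e + 1) ≤ Fintype.card H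
  φ : H → ℂ
  hφ : IsIrrChar H φ

/-- The partial order on `Γ_{p,e}(G)`: `(K, ψ) ≤ (H, φ)` iff `K ≤ H` and
`[φ_K, ψ] ≠ 0`. -/
def GammaLe {p e : ℕ} {G : Type*} [Group G] [Fintype G]
    (a b : GammaPair p e G) : Prop :=
  ∃ h : a.H ≤ b.H, charInner a.H (resChar h b.φ) a.φ ≠ 0

/-- Two elements of `Γ_{p,e}(G)` are connected if joined by a finite zigzag of
comparable pairs. -/
def GammaConnected {p e : ℕ} {G : Type*} [Group G] [Fintype G]
    (a b : GammaPair p e G) : Prop :=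
  Relation.EqvGen (fun x y => GammaLe x y ∨ GammaLe y x) a b

/-- The setoid of connectedness on `Γ_{p,e}(G)`; its quotient is `π₀(Γ_{p,e}(G))`. -/
def gammaSetoid (p e : ℕ) (G : Type*) [Group G] [Fintype G] :
    Setoid (GammaPair p e G) :=
  Relation.EqvGen.setoid (fun x y => GammaLe x y ∨ GammaLe y x)

open Module Representation

open scoped ComplexOrder in
/-- The character of a complex representation of a finite group on column vectors takes
complex-conjugate values at inverse elements. -/
theorem trace_inv_eq_conj {G : Type*} [Group G] [Fintype G] {n : ℕ}
    (ρ : Representation ℂ G (Fin n → ℂ)) (g : G) :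
    LinearMap.trace ℂ (Fin n → ℂ) (ρ g⁻¹) =
      (starRingEnd ℂ) (LinearMap.trace ℂ (Fin n → ℂ) (ρ g)) := by
  set M : G → Matrix (Fin n) (Fin n) ℂ := fun x => LinearMap.toMatrix' (ρ x) with hM
  have hMul : ∀ x y, M (x * y) = M x * M y := fun x y => by
    simp only [hM, map_mul]
    exact LinearMap.toMatrix'_mul _ _
  have hOne : M 1 = 1 := by simp [hM]
  have htr : ∀ x, LinearMap.trace ℂ (Fin n → ℂ) (ρ x) = (M x).trace := fun x => by
    rw [LinearMap.trace_eq_matrix_trace ℂ (Pi.basisFun ℂ (Fin n)),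
      LinearMap.toMatrix_eq_toMatrix']
  set P : Matrix (Fin n) (Fin n) ℂ := ∑ x, (M x).conjTranspose * M x with hP
  have hPpos : P.PosDef := by
    rw [hP, ← Finset.add_sum_erase _ _ (Finset.mem_univ (1 : G))]
    refine Matrix.PosDef.add_posSemidef ?_ ?_
    · rw [hOne]
      simpa using Matrix.PosDef.one
    · exact Matrix.posSemidef_sum _ fun x _ => Matrix.posSemidef_conjTranspose_mul_self _
  have hunit : IsUnit P.det := (Matrix.isUnit_iff_isUnit_det P).1 hPpos.isUnit
  have hinv : (M g).conjTranspose * P * M g = P := by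
    rw [hP, Finset.mul_sum, Finset.sum_mul]
    refine Fintype.sum_equiv (Equiv.mulRight g) _ _ fun x => ?_
    simp [hMul, Matrix.conjTranspose_mul, mul_assoc]
  have hgg : M g * M g⁻¹ = 1 := by rw [← hMul, mul_inv_cancel, hOne]
  have hconj : (M g).conjTranspose = P * M g⁻¹ * P⁻¹ := by
    have h1 : (M g).conjTranspose * P = P * M g⁻¹ := by
      calc (M g).conjTranspose * P = (M g).conjTranspose * P * (M g * M g⁻¹) := by
            rw [hgg, mul_one]
        _ = ((M g).conjTranspose * P * M g) * M g⁻¹ := by simp only [mul_assoc]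
        _ = P * M g⁻¹ := by rw [hinv]
    rw [← h1, mul_assoc, Matrix.mul_nonsing_inv _ hunit, mul_one]
  rw [htr, htr]
  have h2 := Matrix.trace_conjTranspose (M g)
  rw [hconj, mul_assoc, Matrix.trace_mul_comm, mul_assoc, Matrix.nonsing_inv_mul _ hunit,
    mul_one] at h2
  exact h2

/-- The inner product of two characters is the dimension of the space of intertwining maps. -/
theorem charInner_trace_eq_finrank {G : Type*} [Group G] [Fintype G] {m n : ℕ}
    (ρ : Representation ℂ G (Fin m → ℂ)) (σ : Representation ℂ G (Fin n → ℂ)) :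
    charInner G (fun g => LinearMap.trace ℂ _ (σ g)) (fun g => LinearMap.trace ℂ _ (ρ g)) =
      finrank ℂ (IntertwiningMap ρ σ) := by
  let _ : Invertible (Nat.card G : ℂ) :=
    invertibleOfNonzero (Nat.cast_ne_zero.2 Nat.card_pos.ne')
  rw [← card_inv_mul_sum_char_mul_char_eq_finrank, charInner, Nat.card_eq_fintype_card]
  simp only [Representation.character, trace_inv_eq_conj]

theorem IsIrrChar.exists_finrank_eq_one {G : Type*} [Group G] [Fintype G] {χ : G → ℂ}
    (hχ : IsIrrChar G χ) :
    ∃ (n : ℕ) (ρ : Representation ℂ G (Fin n → ℂ)),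
      χ = (fun g => LinearMap.trace ℂ (Fin n → ℂ) (ρ g)) ∧
        finrank ℂ (IntertwiningMap ρ ρ) = 1 := by
  obtain ⟨⟨n, ρ, hρ⟩, h1⟩ := hχ
  obtain rfl : χ = fun g => LinearMap.trace ℂ (Fin n → ℂ) (ρ g) := funext hρ
  refine ⟨n, ρ, rfl, ?_⟩
  rw [charInner_trace_eq_finrank] at h1
  exact_mod_cast h1

theorem charInner_self {G : Type*} [Group G] [Fintype G] (f : G → ℂ) :
    charInner G f f = (((Fintype.card G : ℝ)⁻¹ * ∑ x, ‖f x‖ ^ 2 : ℝ) : ℂ) := by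
  simp [charInner, Complex.mul_conj']

theorem charInner_sub_self {G : Type*} [Group G] [Fintype G] (f g : G → ℂ) :
    charInner G (f - g) (f - g) =
      charInner G f f - charInner G f g - charInner G g f + charInner G g g := by
  simp only [charInner, ← mul_sub, ← mul_add, ← Finset.sum_sub_distrib, ← Finset.sum_add_distrib]
  congr 1
  refine Finset.sum_congr rfl fun x _ => ?_
  simp only [Pi.sub_apply, map_sub]
  ring

/-- Distinct irreducible characters are orthogonal. -/
theorem IsIrrChar.charInner_eq_zero {G : Type*} [Group G] [Fintype G] {χ ψ : G → ℂ}
    (hχ : IsIrrChar G χ) (hψ : IsIrrChar G ψ) (hne : χ ≠ ψ) : charInner G χ ψ = 0 := by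
  obtain ⟨⟨m, ρ, hρ⟩, h1⟩ := hχ
  obtain ⟨⟨n, σ, hσ⟩, h2⟩ := hψ
  have e1 : charInner G χ ψ = finrank ℂ (IntertwiningMap σ ρ) := by
    rw [← charInner_trace_eq_finrank, ← funext hρ, ← funext hσ]
  have e2 : charInner G ψ χ = finrank ℂ (IntertwiningMap ρ σ) := by
    rw [← charInner_trace_eq_finrank, ← funext hρ, ← funext hσ]
  have hsymm : charInner G ψ χ = charInner G χ ψ := by
    have : charInner G ψ χ = (starRingEnd ℂ) (charInner G χ ψ) := by
      simp [charInner, mul_comm]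
    rw [this, e1]
    simp
  by_contra h0
  rw [e1] at h0
  have hpos : 1 ≤ finrank ℂ (IntertwiningMap σ ρ) :=
    Nat.one_le_iff_ne_zero.2 (by exact_mod_cast h0)
  have hsub := charInner_sub_self χ ψ
  rw [hsymm, h1, h2, e1, charInner_self] at hsub
  have hsub' : (Fintype.card G : ℝ)⁻¹ * ∑ x, ‖(χ - ψ) x‖ ^ 2 =
      1 - finrank ℂ (IntertwiningMap σ ρ) - finrank ℂ (IntertwiningMap σ ρ) + 1 := by
    exact_mod_cast hsub
  have hcard : (0 : ℝ) < (Fintype.card G : ℝ)⁻¹ := by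
    have : 0 < Fintype.card G := Fintype.card_pos
    positivity
  have hpos' : (1 : ℝ) ≤ finrank ℂ (IntertwiningMap σ ρ) := by exact_mod_cast hpos
  have hle : ∑ x, ‖(χ - ψ) x‖ ^ 2 ≤ 0 := by
    by_contra! hlt
    have := mul_pos hcard hlt
    linarith
  have hzero : ∑ x, ‖(χ - ψ) x‖ ^ 2 = 0 :=
    le_antisymm hle (Finset.sum_nonneg fun _ _ => by positivity)
  refine hne (funext fun x => ?_)
  have := (Finset.sum_eq_zero_iff_of_nonneg fun _ _ => by positivity).1 hzero x
    (Finset.mem_univ x)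
  simpa [sub_eq_zero] using this

theorem charInner_sum_smul_left {G ι : Type*} [Group G] [Fintype G] (s : Finset ι) (c : ι → ℂ)
    (f : ι → G → ℂ) (g : G → ℂ) :
    charInner G (∑ i ∈ s, c i • f i) g = ∑ i ∈ s, c i * charInner G (f i) g := by
  simp only [charInner, Finset.sum_apply, Pi.smul_apply, smul_eq_mul, Finset.sum_mul,
    Finset.mul_sum]
  rw [Finset.sum_comm]
  exact Finset.sum_congr rfl fun i _ => Finset.sum_congr rfl fun x _ => by ring

theorem finite_isIrrChar (G : Type*) [Group G] [Fintype G] :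
    Finite {χ : G → ℂ // IsIrrChar G χ} := by
  have hli : LinearIndependent ℂ (fun χ : {χ : G → ℂ // IsIrrChar G χ} => χ.1) := by
    rw [linearIndependent_iff']
    intro s c hc i hi
    have h := charInner_sum_smul_left s c (fun χ => χ.1) i.1
    rw [hc, Finset.sum_eq_single i (fun j _ hji => ?_) (fun hn => (hn hi).elim), i.2.2] at h
    · simpa [charInner] using h.symm
    · rw [j.2.charInner_eq_zero i.2 fun h => hji (Subtype.ext h), mul_zero]
  exact hli.finite

/-- Central elements act on an irreducible character through multiplication by a scalar of
modulus one. -/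
theorem IsIrrChar.exists_central_scalar {G : Type*} [Group G] [Fintype G] {χ : G → ℂ}
    (hχ : IsIrrChar G χ) {z : G} (hz : z ∈ Subgroup.center G) :
    ∃ c : ℂ, ‖c‖ = 1 ∧ ∀ g, χ (g * z) = c * χ g := by
  obtain ⟨n, ρ, rfl, h1⟩ := hχ.exists_finrank_eq_one
  let a : IntertwiningMap ρ ρ :=
    ⟨LinearMap.id, fun g => by ext; simp⟩
  let b : IntertwiningMap ρ ρ :=
    ⟨ρ z, fun g => by
      change ρ z * ρ g = ρ g * ρ z
      rw [← map_mul, ← map_mul, Subgroup.mem_center_iff.1 hz g]⟩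
  have ha : a ≠ 0 := by
    intro ha
    have hid : (LinearMap.id : (Fin n → ℂ) →ₗ[ℂ] (Fin n → ℂ)) = 0 :=
      congrArg IntertwiningMap.toLinearMap ha
    have : Subsingleton (IntertwiningMap ρ ρ) := ⟨fun f g => by
      apply IntertwiningMap.ext
      rw [← LinearMap.comp_id f.toLinearMap, ← LinearMap.comp_id g.toLinearMap, hid]
      simp⟩
    rw [finrank_zero_of_subsingleton] at h1
    exact zero_ne_one h1
  obtain ⟨c, hc⟩ := exists_smul_eq_of_finrank_eq_one h1 ha b
  have hcz : ρ z = c • (1 : Module.End ℂ (Fin n → ℂ)) :=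
    (congrArg IntertwiningMap.toLinearMap hc).symm
  refine ⟨c, ?_, fun g => ?_⟩
  · have h10 : (1 : Module.End ℂ (Fin n → ℂ)) ≠ 0 := fun h => ha (IntertwiningMap.ext h)
    have hpow : c ^ Fintype.card G • (1 : Module.End ℂ (Fin n → ℂ)) = (1 : ℂ) • 1 := by
      rw [one_smul, ← one_pow (M := Module.End ℂ (Fin n → ℂ)) (Fintype.card G), ← smul_pow,
        ← hcz, ← map_pow, pow_card_eq_one, map_one, one_pow]
    have hc1 : c ^ Fintype.card G = 1 := smul_left_injective ℂ h10 hpow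
    exact Complex.norm_eq_one_of_pow_eq_one hc1 Fintype.card_ne_zero
  · simp [map_mul, hcz]

/-- Transport of a finite-dimensional representation to column vectors. -/
theorem exists_representation_fin {G V : Type*} [Group G] [AddCommGroup V] [Module ℂ V]
    [FiniteDimensional ℂ V] (ρ : Representation ℂ G V) :
    ∃ σ : Representation ℂ G (Fin (finrank ℂ V) → ℂ),
      ∀ (g : G) (c : ℂ), ρ g = c • (1 : Module.End ℂ V) → σ g = c • 1 := by
  let e : V ≃ₗ[ℂ] (Fin (finrank ℂ V) → ℂ) := (finBasis ℂ V).equivFun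
  refine ⟨(e.conjRingEquiv : _ →* _).comp ρ, fun g c h => ?_⟩
  rw [MonoidHom.comp_apply, h]
  refine LinearMap.ext fun v => ?_
  simp

/-- Every linear character of a central subgroup lies under an irreducible character. -/
theorem exists_isIrrChar_central {Z G : Type*} [Group Z] [Group G] [Fintype G] (ι : Z →* G)
    (hι : Function.Injective ι) (hcen : ∀ z, ι z ∈ Subgroup.center G) (l : Z →* ℂˣ) :
    ∃ χ : G → ℂ, IsIrrChar G χ ∧ ∀ z g, χ (g * ι z) = l z * χ g := by
  have hex : ∃ n : ℕ, 0 < n ∧ ∃ ρ : Representation ℂ G (Fin n → ℂ),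
      ∀ z, ρ (ι z) = (l z : ℂ) • 1 := by
    let τ : Representation ℂ Z ℂ :=
      ((Algebra.lmul ℂ ℂ : ℂ →* Module.End ℂ ℂ).comp (Units.coeHom ℂ)).comp l
    have hτ : ∀ z a, τ z a = l z * a := fun z a => rfl
    obtain ⟨σ, hσ⟩ := exists_representation_fin (Representation.coind ι τ)
    refine ⟨_, ?_, σ, fun z => hσ _ _ ?_⟩
    · let f : G → ℂ := fun g => if h : ∃ z, ι z = g then l h.choose else 0
      have hf : ∀ z, f (ι z) = l z := fun z => by
        have h : ∃ z', ι z' = ι z := ⟨z, rfl⟩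
        simp only [f, dif_pos h, hι h.choose_spec]
      have hf0 : ∀ g, (¬ ∃ z, ι z = g) → f g = 0 := fun g h => dif_neg h
      have hmem : f ∈ Representation.coindV ι τ := by
        intro z g
        rw [hτ]
        by_cases h : ∃ z', ι z' = g
        · obtain ⟨z', rfl⟩ := h
          rw [← map_mul, hf, hf, map_mul, Units.val_mul]
        · rw [hf0 g h, hf0, mul_zero]
          rintro ⟨w, hw⟩
          exact h ⟨z⁻¹ * w, by rw [map_mul, map_inv, hw, inv_mul_cancel_left]⟩
      refine Module.finrank_pos_iff_exists_ne_zero.2 ⟨⟨f, hmem⟩, fun h => ?_⟩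
      have h1 := hf 1
      rw [show f = 0 from congrArg Subtype.val h] at h1
      simp at h1
    · ext v g
      have := v.2 z g
      rw [hτ, ← Subgroup.mem_center_iff.1 (hcen z) g] at this
      exact this
  obtain ⟨hpos, ρ, hρ⟩ := Nat.find_spec hex
  have hmin := fun m => Nat.find_min (m := m) hex
  generalize Nat.find hex = n at hpos ρ hρ hmin
  have : Nonempty (Fin n) := ⟨⟨0, hpos⟩⟩
  have hscalar : ∀ f : IntertwiningMap ρ ρ, ∃ c : ℂ, f.toLinearMap = c • 1 := by
    intro f
    obtain ⟨c, hc⟩ := Module.End.exists_eigenvalue f.toLinearMap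
    refine ⟨c, ?_⟩
    let W : Subrepresentation ρ :=
      ⟨Module.End.eigenspace f.toLinearMap c, fun g v hv => by
        rw [Module.End.mem_eigenspace_iff] at hv ⊢
        rw [IntertwiningMap.toLinearMap_apply, f.isIntertwining,
          ← IntertwiningMap.toLinearMap_apply, hv, map_smul]⟩
    have hWpos : 0 < finrank ℂ W.toSubmodule := by
      rw [Module.finrank_pos_iff, Submodule.nontrivial_iff_ne_bot]
      exact hc
    have hWle : n ≤ finrank ℂ W.toSubmodule := by
      by_contra! hlt
      refine hmin _ hlt ⟨hWpos, ?_⟩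
      obtain ⟨σ, hσ⟩ := exists_representation_fin W.toRepresentation
      refine ⟨σ, fun z => hσ _ _ ?_⟩
      ext v
      simp [Subrepresentation.toRepresentation, hρ]
    have hWtop : W.toSubmodule = ⊤ := by
      apply Submodule.eq_top_of_finrank_eq
      refine le_antisymm (Submodule.finrank_le _) ?_
      simpa using hWle
    refine LinearMap.ext fun v => ?_
    have hv : v ∈ W.toSubmodule := hWtop ▸ Submodule.mem_top
    exact Module.End.mem_eigenspace_iff.1 hv
  refine ⟨fun g => LinearMap.trace ℂ _ (ρ g), ⟨⟨n, ρ, fun _ => rfl⟩, ?_⟩, fun z g => ?_⟩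
  · rw [charInner_trace_eq_finrank, Nat.cast_eq_one]
    refine finrank_eq_one (⟨LinearMap.id, fun g => by ext; simp⟩ : IntertwiningMap ρ ρ) ?_ ?_
    · intro h
      have hid : (1 : Module.End ℂ (Fin n → ℂ)) = 0 := congrArg IntertwiningMap.toLinearMap h
      exact one_ne_zero hid
    · intro f
      obtain ⟨c, hc⟩ := hscalar f
      exact ⟨c, IntertwiningMap.ext hc.symm⟩
  · simp [map_mul, hρ]

theorem finite_gammaPair (p e : ℕ) (G : Type*) [Group G] [Fintype G] :
    Finite (GammaPair p e G) := by
  have : ∀ H : Subgroup G, Finite {χ : H → ℂ // IsIrrChar H χ} := fun H => finite_isIrrChar H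
  refine Finite.of_injective
    (fun a : GammaPair p e G =>
      (⟨a.H, a.φ, a.hφ⟩ : Σ H : Subgroup G, {χ : H → ℂ // IsIrrChar H χ})) ?_
  rintro ⟨H, hH, φ, hφ⟩ ⟨K, hK, ψ, hψ⟩ h
  obtain ⟨rfl, h⟩ := Sigma.mk.inj h
  obtain rfl := congrArg Subtype.val (eq_of_heq h)
  rfl

/-- `z` acts on the character of the pair `a` through multiplication by `c`. -/
def HasCentralValue {p e : ℕ} {G : Type*} [Group G] [Fintype G] (a : GammaPair p e G) (z : G)
    (c : ℂ) : Prop :=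
  ‖c‖ = 1 ∧ ∃ h : z ∈ a.H, ∀ g : a.H, a.φ (g * ⟨z, h⟩) = c * a.φ g

theorem GammaPair.exists_hasCentralValue {p e : ℕ} {G : Type*} [Group G] [Fintype G]
    (a : GammaPair p e G) {z : G} (hz : z ∈ Subgroup.center G) (hza : z ∈ a.H) :
    ∃ c, HasCentralValue a z c := by
  have hcen : (⟨z, hza⟩ : a.H) ∈ Subgroup.center a.H :=
    Subgroup.mem_center_iff.2 fun g => Subtype.ext (Subgroup.mem_center_iff.1 hz g)
  obtain ⟨c, hc, h⟩ := a.hφ.exists_central_scalar hcen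
  exact ⟨c, hc, hza, h⟩

theorem GammaLe.centralValue_eq {p e : ℕ} {G : Type*} [Group G] [Fintype G]
    {a b : GammaPair p e G} (hab : GammaLe a b) {z : G} {c d : ℂ}
    (ha : HasCentralValue a z c) (hb : HasCentralValue b z d) : c = d := by
  obtain ⟨hle, hne⟩ := hab
  obtain ⟨hc, hza, ha⟩ := ha
  obtain ⟨-, hzb, hb⟩ := hb
  have hshift : charInner a.H (resChar hle b.φ) a.φ =
      d * (starRingEnd ℂ) c * charInner a.H (resChar hle b.φ) a.φ := by
    conv_lhs => rw [charInner]
    rw [← Equiv.sum_comp (Equiv.mulRight (⟨z, hza⟩ : a.H)), charInner, mul_left_comm]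
    congr 1
    rw [Finset.mul_sum]
    refine Finset.sum_congr rfl fun x _ => ?_
    have hx : resChar hle b.φ (x * ⟨z, hza⟩) = d * resChar hle b.φ x :=
      hb (Subgroup.inclusion hle x)
    rw [Equiv.coe_mulRight, hx, ha, map_mul]
    ring
  have hone : d * (starRingEnd ℂ) c = 1 := (mul_eq_right₀ hne).1 hshift.symm
  calc c = d * (starRingEnd ℂ) c * c := by rw [hone, one_mul]
    _ = d * (c * (starRingEnd ℂ) c) := by ring
    _ = d := by rw [Complex.mul_conj', hc]; simp

theorem HasCentralValue.unique {p e : ℕ} {G : Type*} [Group G] [Fintype G]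
    {a : GammaPair p e G} {z : G} {c d : ℂ}
    (hc : HasCentralValue a z c) (hd : HasCentralValue a z d) : c = d := by
  refine GammaLe.centralValue_eq (a := a) (b := a) ⟨le_rfl, ?_⟩ hc hd
  have h : charInner a.H (resChar le_rfl a.φ) a.φ = 1 := a.hφ.2
  rw [h]
  exact one_ne_zero

/-- The intersection of all subgroups of order `p ^ k` of a `p`-group is contained in every
subgroup of order at least `p ^ k`. -/
theorem iInf_card_eq_le {p k : ℕ} (hp : p.Prime) {G : Type*} [Group G] [Fintype G]
    (hG : IsPGroup p G) (H : Subgroup G) (hH : p ^ k ≤ Fintype.card H) :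
    (⨅ (K : Subgroup G) (_ : Fintype.card K = p ^ k), K) ≤ H := by
  have := Fact.mk hp
  obtain ⟨m, hm⟩ := IsPGroup.iff_card.1 (hG.to_subgroup H)
  have hdvd : p ^ k ∣ Nat.card H := by
    rw [← Nat.card_eq_fintype_card, hm] at hH
    rw [hm]
    exact pow_dvd_pow p ((Nat.pow_le_pow_iff_right hp.one_lt).1 hH)
  obtain ⟨K, hK⟩ := Sylow.exists_subgroup_card_pow_prime p hdvd
  have hK' : Fintype.card (K.map H.subtype) = p ^ k := by
    rw [← Nat.card_eq_fintype_card, Subgroup.card_map_of_injective H.subtype_injective, hK]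
  refine le_trans ?_ (Subgroup.map_subtype_le K)
  exact iInf₂_le (f := fun (K : Subgroup G) (_ : Fintype.card K = p ^ k) => K) _ hK'

/-- `|I ∩ Z(G)| ≤ |π₀(Γ_{p,e}(G))|` where `I` is the intersection
of all subgroups of `G` of order `p^(e+1)`. -/
theorem card_inter_center_le_components {p e : ℕ} (hp : p.Prime)
    {G : Type*} [Group G] [Fintype G] (hG : IsPGroup p G)
    (hdvd : p ^ (e + 1) ∣ Fintype.card G)
    (I : Subgroup G)
    (hI : I = ⨅ (H : Subgroup G) (_ : Fintype.card H = p ^ (e + 1)), H) :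
    Nat.card ↥(I ⊓ Subgroup.center G) ≤
      Nat.card (Quotient (gammaSetoid p e G)) := by
  set Z : Subgroup G := I ⊓ Subgroup.center G with hZ
  have hZH : ∀ (a : GammaPair p e G) (z : Z), (z : G) ∈ a.H := fun a z =>
    iInf_card_eq_le hp hG a.H a.hH (hI ▸ z.2.1)
  have hconn : ∀ a b : GammaPair p e G,
      Relation.EqvGen (fun x y => GammaLe x y ∨ GammaLe y x) a b →
      ∀ (z : Z) (c d : ℂ), HasCentralValue a z c → HasCentralValue b z d → c = d := by
    intro a b hab z
    induction hab with
    | rel x y h =>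
      intro c d hc hd
      exact h.elim (fun h => h.centralValue_eq hc hd) fun h => (h.centralValue_eq hd hc).symm
    | refl x => exact fun c d hc hd => hc.unique hd
    | symm x y _ ih => exact fun c d hc hd => (ih d c hd hc).symm
    | trans x y w _ _ ih₁ ih₂ =>
      intro c d hc hd
      obtain ⟨c', hc'⟩ := y.exists_hasCentralValue z.2.2 (hZH y z)
      exact (ih₁ c c' hc hc').trans (ih₂ c' d hc' hd)
  have htop : p ^ (e + 1) ≤ Fintype.card (⊤ : Subgroup G) := by
    rw [← Nat.card_eq_fintype_card, Subgroup.card_top, Nat.card_eq_fintype_card]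
    exact Nat.le_of_dvd Fintype.card_pos hdvd
  have hpair : ∀ l : Z →* ℂˣ, ∃ a : GammaPair p e G, ∀ z : Z, HasCentralValue a z (l z) := by
    intro l
    obtain ⟨χ, hχ, h⟩ := exists_isIrrChar_central
      (Subgroup.inclusion (le_top : Z ≤ ⊤)) (Subgroup.inclusion_injective _)
      (fun z => Subgroup.mem_center_iff.2 fun g =>
        Subtype.ext (Subgroup.mem_center_iff.1 z.2.2 (g : G))) l
    refine ⟨⟨⊤, htop, χ, hχ⟩, fun z => ⟨?_, Subgroup.mem_top _, fun g => h z g⟩⟩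
    refine Complex.norm_eq_one_of_pow_eq_one (n := Nat.card Z) ?_ Nat.card_pos.ne'
    rw [← Units.val_pow_eq_pow_val, ← map_pow, pow_card_eq_one', map_one, Units.val_one]
  choose a ha using hpair
  let _ : CommGroup Z :=
    { (inferInstance : Group Z) with
      mul_comm := fun x y => Subtype.ext (Subgroup.mem_center_iff.1 y.2.2 x) }
  rw [← CommGroup.card_monoidHom_of_hasEnoughRootsOfUnity Z ℂ]
  have := finite_gammaPair p e G
  refine Nat.card_le_card_of_injective
    (fun l : Z →* ℂˣ => Quotient.mk (gammaSetoid p e G) (a l)) fun l l' hl => ?_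
  ext z
  exact hconn _ _ (Quotient.exact hl) z _ _ (ha l z) (ha l' z)
end
end
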